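/- Let H be an m×m real matrix with all entries ±1 such that H is symmetric, H² = m·I_m, every diagonal entry of H equals −1, and H·J_m = J_m·H = l·J_m where l is an integer with l² = m and m ≥ 4 (H is a regular graphical Hadamard matrix with diagonal −1 and row sum l). Let n ≥ 2 and let A = ((J_m + H)/2) ⊗ I_n + ((J_m − H)/2) ⊗ (J_n − I_n), i.e. the matrix obtained from H by replacing each entry −1 by J_n − I_n and each entry +1 by I_n. Then A satisfies A² = k·I + λ₁·(K − I) + λ₂·(J − K) with K = I_m ⊗ J_n, k = n(m − l)/2 + l, λ₁ = (n − 2)(m − l)/2 and λ₂ = n(m − 2l)/4 + l; that is, A is the adjacency matrix of a divisible design graph with parameters (mn, n(m−l)/2 + l, (n−2)(m−l)/2, n(m−2l)/4 + l, m, n). -/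

import Mathlib

open Matrix Kronecker

/-- The all-ones matrix. -/
def allOnes (ι : Type*) : Matrix ι ι ℝ := Matrix.of fun _ _ => 1

/-- `A` is the adjacency matrix of a divisible design graph whose canonical
partition has classes indexed by `cl` and class members indexed by `pt`. -/
def IsDDGAdj {cl pt : Type*} [Fintype cl] [DecidableEq cl] [Fintype pt] [DecidableEq pt]
    (k l1 l2 : ℝ) (A : Matrix (cl × pt) (cl × pt) ℝ) : Prop :=
  A.IsSymm ∧ (∀ x y, A x y = 0 ∨ A x y = 1) ∧ (∀ x, A x x = 0) ∧
  A * A = k • (1 : Matrix (cl × pt) (cl × pt) ℝ)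
      + l1 • ((1 : Matrix cl cl ℝ) ⊗ₖ allOnes pt - 1)
      + l2 • (allOnes (cl × pt) - (1 : Matrix cl cl ℝ) ⊗ₖ allOnes pt)

theorem allOnes_mul_allOnes (ι : Type*) [Fintype ι] :
    allOnes ι * allOnes ι = (Fintype.card ι : ℝ) • allOnes ι := by
  ext i j
  simp [allOnes, Matrix.mul_apply]

theorem allOnes_prod (ι κ : Type*) : allOnes (ι × κ) = allOnes ι ⊗ₖ allOnes κ := by
  ext i j
  simp [allOnes]

theorem kronecker_replacement_eq {ι κ : Type*} [DecidableEq κ] (H : Matrix ι ι ℝ) :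
    ((1 / 2 : ℝ) • (allOnes ι + H)) ⊗ₖ (1 : Matrix κ κ ℝ)
        + ((1 / 2 : ℝ) • (allOnes ι - H)) ⊗ₖ (allOnes κ - 1)
      = H ⊗ₖ (1 : Matrix κ κ ℝ) + ((1 / 2 : ℝ) • (allOnes ι - H)) ⊗ₖ allOnes κ := by
  ext ⟨i, a⟩ ⟨j, b⟩
  simp only [Matrix.add_apply, Matrix.sub_apply, Matrix.smul_apply, kroneckerMap_apply,
    smul_eq_mul]
  ring

/-- The square of the matrix obtained from `H` by the block replacement. -/
theorem kronecker_replacement_mul_self {ι κ : Type*} [Fintype ι] [DecidableEq ι]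
    [Fintype κ] [DecidableEq κ] (H : Matrix ι ι ℝ) (l : ℝ)
    (hHH : H * H = (Fintype.card ι : ℝ) • (1 : Matrix ι ι ℝ))
    (hrow : H * allOnes ι = l • allOnes ι) (hcol : allOnes ι * H = l • allOnes ι) :
    (H ⊗ₖ (1 : Matrix κ κ ℝ) + ((1 / 2 : ℝ) • (allOnes ι - H)) ⊗ₖ allOnes κ)
        * (H ⊗ₖ (1 : Matrix κ κ ℝ) + ((1 / 2 : ℝ) • (allOnes ι - H)) ⊗ₖ allOnes κ)
      = (Fintype.card ι : ℝ) • (1 : Matrix (ι × κ) (ι × κ) ℝ)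
        + ((Fintype.card κ : ℝ) * Fintype.card ι / 4 - Fintype.card ι)
          • ((1 : Matrix ι ι ℝ) ⊗ₖ allOnes κ)
        + ((Fintype.card κ : ℝ) * (Fintype.card ι - 2 * l) / 4 + l)
          • allOnes (ι × κ) := by
  rw [allOnes_prod, ← one_kronecker_one (m := ι) (n := κ)]
  simp only [add_mul, mul_add, ← mul_kronecker_mul, smul_mul_assoc, mul_smul_comm, sub_mul,
    mul_sub, hHH, hrow, hcol, allOnes_mul_allOnes, one_mul, mul_one]
  ext ⟨i, a⟩ ⟨j, b⟩
  simp only [Matrix.add_apply, Matrix.sub_apply, Matrix.smul_apply, kroneckerMap_apply,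
    smul_eq_mul]
  ring

/-- From a regular graphical Hadamard matrix `H` of order `m ≥ 4` with diagonal `−1` and
row sum `l = ±√m`: replacing every entry `−1` by `J_n − I_n` and every entry `+1` by `I_n`
(`n ≥ 2`) yields the adjacency matrix of a divisible design graph with parameters
`(mn, n(m−l)/2 + l, (n−2)(m−l)/2, n(m−2l)/4 + l, m, n)`. -/
theorem ddg_construction_hadamard (m n : ℕ) (hm : 4 ≤ m) (hn : 2 ≤ n)
    (l : ℤ) (hl : l ^ 2 = (m : ℤ))
    (H : Matrix (Fin m) (Fin m) ℝ)
    (hentries : ∀ i j, H i j = 1 ∨ H i j = -1)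
    (hsym : H.IsSymm)
    (hHH : H * H = (m : ℝ) • (1 : Matrix (Fin m) (Fin m) ℝ))
    (hdiag : ∀ i, H i i = -1)
    (hrow : H * allOnes (Fin m) = (l : ℝ) • allOnes (Fin m))
    (hcol : allOnes (Fin m) * H = (l : ℝ) • allOnes (Fin m)) :
    IsDDGAdj ((n : ℝ) * ((m : ℝ) - (l : ℝ)) / 2 + (l : ℝ))
      (((n : ℝ) - 2) * ((m : ℝ) - (l : ℝ)) / 2)
      ((n : ℝ) * ((m : ℝ) - 2 * (l : ℝ)) / 4 + (l : ℝ))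
      (((1 / 2 : ℝ) • (allOnes (Fin m) + H)) ⊗ₖ (1 : Matrix (Fin n) (Fin n) ℝ)
        + ((1 / 2 : ℝ) • (allOnes (Fin m) - H)) ⊗ₖ (allOnes (Fin n) - 1)) := by
  refine ⟨?_, ?_, ?_, ?_⟩
  · ext ⟨i, a⟩ ⟨j, b⟩
    simp [allOnes, Matrix.one_apply, hsym.apply i j, eq_comm (a := a)]
  · rintro ⟨i, a⟩ ⟨j, b⟩
    rcases hentries i j with h | h <;> by_cases hab : a = b <;>
      norm_num [allOnes, Matrix.one_apply, h, hab]
  · rintro ⟨i, a⟩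
    simp [allOnes, hdiag i]
  · rw [kronecker_replacement_eq,
      kronecker_replacement_mul_self H l (by simpa using hHH) hrow hcol]
    simp only [Fintype.card_fin]
    module
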